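/- Let p be a probability density function on ℝ that is compactly supported, even, and non-increasing on [0, ∞) ∩ supp(p). Let X have density p, let N be a standard Gaussian random variable independent of X, and set Y = X + N. Then for every integer k ≥ 1 there exists a constant D (depending only on p and k) such that for every integer n ≥ max(k − 1, 1): inf over polynomials q of degree at most n of ( E[(q(Y) − E[X | Y])²] )^{1/2} ≤ D / n^{k/2}. -/

import Mathlib

open MeasureTheory ProbabilityTheory

section Hermite

open Polynomial

theorem integrable_eval_gaussianReal (p : ℝ[X]) :
    Integrable (fun x => p.eval x) (gaussianReal 0 1) := by
  induction p using Polynomial.induction_on' with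
  | add p q hp hq => exact (hp.add hq).congr (.of_forall fun x => by simp)
  | monomial n a =>
    simp only [eval_monomial]
    exact (integrable_pow_of_mem_interior_integrableExpSet (X := id)
      (by simp [integrableExpSet_id_gaussianReal]) n).const_mul a

theorem memLp_eval_gaussianReal (p : ℝ[X]) :
    MemLp (fun x => p.eval x) 2 (gaussianReal 0 1) := by
  rw [memLp_two_iff_integrable_sq p.continuous.aestronglyMeasurable]
  exact (integrable_eval_gaussianReal (p ^ 2)).congr (.of_forall fun x => by simp)

theorem integral_mul_gaussianPDFReal (f : ℝ → ℝ) :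
    ∫ x, f x ∂gaussianReal 0 1 = ∫ x, f x * gaussianPDFReal 0 1 x := by
  rw [integral_gaussianReal_eq_integral_smul one_ne_zero]
  simp [mul_comm]

theorem integrable_mul_gaussianPDFReal {f : ℝ → ℝ} (hf : Integrable f (gaussianReal 0 1)) :
    Integrable (fun x => f x * gaussianPDFReal 0 1 x) := by
  rw [gaussianReal_of_var_ne_zero _ one_ne_zero,
    integrable_withDensity_iff (measurable_gaussianPDF 0 1)
      (Filter.Eventually.of_forall fun _ => gaussianPDF_lt_top)] at hf
  simpa only [toReal_gaussianPDF] using hf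

theorem hasDerivAt_gaussianPDFReal (x : ℝ) :
    HasDerivAt (gaussianPDFReal 0 1) (-x * gaussianPDFReal 0 1 x) x := by
  unfold gaussianPDFReal
  have h : HasDerivAt (fun y : ℝ => -(y - 0) ^ 2 / (2 * ((1 : NNReal) : ℝ))) (-x) x := by
    have := (((hasDerivAt_id x).sub_const 0).pow 2).neg.div_const (2 * ((1 : NNReal) : ℝ))
    exact this.congr_deriv (by simp; ring)
  exact (h.exp.const_mul _).congr_deriv (by ring)

theorem integral_mul_eval_X_mul_sub_derivative {g g' : ℝ → ℝ}
    (hg : ∀ x, HasDerivAt g (g' x) x) (hg2 : MemLp g 2 (gaussianReal 0 1))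
    (hg2' : MemLp g' 2 (gaussianReal 0 1)) (h : ℝ[X]) :
    ∫ x, g x * (X * h - derivative h).eval x ∂gaussianReal 0 1
      = ∫ x, g' x * h.eval x ∂gaussianReal 0 1 := by
  have hv : ∀ x, HasDerivAt (fun x => h.eval x * gaussianPDFReal 0 1 x)
      (-((X * h - derivative h).eval x * gaussianPDFReal 0 1 x)) x := by
    intro x
    exact ((h.hasDerivAt x).mul (hasDerivAt_gaussianPDFReal x)).congr_deriv (by simp; ring)
  have key := integral_mul_deriv_eq_deriv_mul_of_integrable (fun x _ => hg x) (fun x _ => hv x)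
    (by
      convert! (integrable_mul_gaussianPDFReal
        (hg2.integrable_mul (memLp_eval_gaussianReal (X * h - derivative h)))).neg using 1
      ext x; simp; ring)
    (by
      convert! (integrable_mul_gaussianPDFReal
        (hg2'.integrable_mul (memLp_eval_gaussianReal h))) using 1
      ext x; simp; ring)
    (by
      convert! (integrable_mul_gaussianPDFReal
        (hg2.integrable_mul (memLp_eval_gaussianReal h))) using 1
      ext x; simp; ring)
  rw [integral_mul_gaussianPDFReal, integral_mul_gaussianPDFReal]
  simp only [mul_neg, integral_neg, neg_inj] at key
  simpa only [mul_assoc] using key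

/-- The probabilists' Hermite polynomials, with real coefficients. -/
noncomputable def hermiteReal (n : ℕ) : ℝ[X] := (hermite n).map (Int.castRingHom ℝ)

theorem hermiteReal_succ (n : ℕ) :
    hermiteReal (n + 1) = X * hermiteReal n - derivative (hermiteReal n) := by
  simp [hermiteReal, hermite_succ, derivative_map]

theorem hermiteReal_zero : hermiteReal 0 = 1 := by simp [hermiteReal]

theorem natDegree_hermiteReal (n : ℕ) : (hermiteReal n).natDegree = n := by
  rw [hermiteReal, (hermite_monic n).natDegree_map, natDegree_hermite]

theorem monic_hermiteReal (n : ℕ) : (hermiteReal n).Monic := (hermite_monic n).map _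

theorem integral_mul_eval_hermiteReal {F : ℕ → ℝ → ℝ}
    (hF : ∀ i x, HasDerivAt (F i) (F (i + 1) x) x)
    (hF2 : ∀ i, MemLp (F i) 2 (gaussianReal 0 1)) (i m j : ℕ) :
    ∫ x, F i x * (hermiteReal (m + j)).eval x ∂gaussianReal 0 1
      = ∫ x, F (i + j) x * (hermiteReal m).eval x ∂gaussianReal 0 1 := by
  induction j generalizing i with
  | zero => rfl
  | succ j ih =>
    rw [← add_assoc, hermiteReal_succ,
      integral_mul_eval_X_mul_sub_derivative (hF i) (hF2 i) (hF2 (i + 1)), ih, add_right_comm,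
      add_assoc]

theorem integral_eval_mul_eval_hermiteReal (p : ℝ[X]) (j : ℕ) (hp : p.natDegree ≤ j) :
    ∫ x, p.eval x * (hermiteReal j).eval x ∂gaussianReal 0 1 = j.factorial * p.coeff j := by
  have h := integral_mul_eval_hermiteReal (F := fun i x => (derivative^[i] p).eval x)
    (fun i x => by
      simpa only [Function.iterate_succ_apply'] using (derivative^[i] p).hasDerivAt x)
    (fun i => memLp_eval_gaussianReal _) 0 0 j
  have hc : derivative^[j] p = C (j.factorial * p.coeff j : ℝ) := by
    rw [eq_C_of_natDegree_le_zero (p := derivative^[j] p)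
      ((natDegree_iterate_derivative p j).trans (by omega)), coeff_iterate_derivative]
    simp [Nat.descFactorial_self]
  simpa [hermiteReal_zero, hc] using h

theorem integral_eval_hermiteReal_mul (i j : ℕ) :
    ∫ x, (hermiteReal i).eval x * (hermiteReal j).eval x ∂gaussianReal 0 1
      = if i = j then (j.factorial : ℝ) else 0 := by
  wlog hij : i ≤ j generalizing i j
  · simp_rw [mul_comm (eval _ (hermiteReal i)), this j i (le_of_not_ge hij), eq_comm (a := i)]
    split_ifs with h <;> simp [h]
  rw [integral_eval_mul_eval_hermiteReal _ _ ((natDegree_hermiteReal i).trans_le hij)]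
  split_ifs with h
  · subst h
    have := monic_hermiteReal i
    rw [Monic, leadingCoeff, natDegree_hermiteReal] at this
    simp [this]
  · rw [coeff_eq_zero_of_natDegree_lt]
    · simp
    · rw [natDegree_hermiteReal]; omega

end Hermite

section Jackson

open Polynomial

theorem integrable_exp_abs_mul_abs_gaussianReal {u : ℝ → ℝ}
    (hu : MemLp u 2 (gaussianReal 0 1)) (t : ℝ) :
    Integrable (fun x => Real.exp |t * x| * |u x|) (gaussianReal 0 1) := by
  have h : MemLp (fun x : ℝ => Real.exp |t * x|) 2 (gaussianReal 0 1) := by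
    rw [memLp_two_iff_integrable_sq (by fun_prop)]
    have := integrable_exp_mul_abs (t := 2 * |t|)
      (integrable_exp_mul_gaussianReal (μ := 0) (v := 1) (2 * |t|))
      (integrable_exp_mul_gaussianReal (μ := 0) (v := 1) (-(2 * |t|)))
    refine this.congr (.of_forall fun x => ?_)
    simp only [← Real.exp_nat_mul, abs_mul]
    congr 1
    push_cast
    ring
  exact h.integrable_mul hu.abs

theorem integral_cexp_mul_eq_zero {u : ℝ → ℝ} (hu : MemLp u 2 (gaussianReal 0 1))
    (h : ∀ n : ℕ, ∫ x, x ^ n * u x ∂gaussianReal 0 1 = 0) (t : ℝ) :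
    ∫ x, Complex.exp (t * x * Complex.I) * (u x : ℂ) ∂gaussianReal 0 1 = 0 := by
  have hs := hasSum_integral_of_dominated_convergence (μ := gaussianReal 0 1)
    (F := fun (n : ℕ) (x : ℝ) => (t * x * Complex.I : ℂ) ^ n / (n.factorial : ℂ) * (u x : ℂ))
    (f := fun x : ℝ => Complex.exp (t * x * Complex.I) * (u x : ℂ))
    (fun n x => |t * x| ^ n / n.factorial * |u x|)
    (fun n => by
      refine AEStronglyMeasurable.mul (Continuous.aestronglyMeasurable (by fun_prop)) ?_
      exact Complex.continuous_ofReal.comp_aestronglyMeasurable hu.aestronglyMeasurable)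
    (fun n => .of_forall fun x => by simp [mul_pow])
    (.of_forall fun x => (Real.summable_pow_div_factorial _).mul_right _)
    (by
      refine (integrable_exp_abs_mul_abs_gaussianReal hu t).congr (.of_forall fun x => ?_)
      simp only [tsum_mul_right]
      rw [Real.exp_eq_exp_ℝ, NormedSpace.exp_eq_tsum_div])
    (.of_forall fun x => by
      refine HasSum.mul_right _ ?_
      rw [Complex.exp_eq_exp_ℂ]
      exact NormedSpace.expSeries_div_hasSum_exp _)
  refine hs.unique ?_
  have hz : ∀ n : ℕ, ∫ x, (t * x * Complex.I : ℂ) ^ n / (n.factorial : ℂ) * (u x : ℂ)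
      ∂gaussianReal 0 1 = 0 := by
    intro n
    have : ∀ x : ℝ, (t * x * Complex.I : ℂ) ^ n / (n.factorial : ℂ) * (u x : ℂ)
        = ((t * Complex.I : ℂ) ^ n / (n.factorial : ℂ)) * ((x ^ n * u x : ℝ) : ℂ) := by
      intro x; push_cast; ring
    simp_rw [this]
    rw [integral_const_mul, integral_complex_ofReal, h n]
    simp
  simp_rw [hz]
  exact hasSum_zero

theorem ae_eq_zero_of_integral_pow_mul_eq_zero {u : ℝ → ℝ} (hu : MemLp u 2 (gaussianReal 0 1))
    (h : ∀ n : ℕ, ∫ x, x ^ n * u x ∂gaussianReal 0 1 = 0) : u =ᵐ[gaussianReal 0 1] 0 := by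
  have hi : Integrable u (gaussianReal 0 1) := hu.integrable (by norm_num)
  have hm : AEMeasurable u (gaussianReal 0 1) := hi.aemeasurable
  have := isFiniteMeasure_withDensity_ofReal hi.2
  have := isFiniteMeasure_withDensity_ofReal hi.neg.2
  have hexp : ∀ (t : ℝ) {w : ℝ → ℝ}, Integrable w (gaussianReal 0 1) →
      Integrable (fun x => w x • Complex.exp (t * x * Complex.I)) (gaussianReal 0 1) := by
    intro t w hw
    have hc : Continuous fun x : ℝ => Complex.exp (t * x * Complex.I) := by fun_prop
    refine (hw.norm).mono (hw.aestronglyMeasurable.smul hc.aestronglyMeasurable)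
      (.of_forall fun x => ?_)
    rw [norm_smul, ← Complex.ofReal_mul, Complex.norm_exp_ofReal_mul_I]
    simp
  have heq : (gaussianReal 0 1).withDensity (fun x => ENNReal.ofReal (u x))
      = (gaussianReal 0 1).withDensity (fun x => ENNReal.ofReal ((-u) x)) := by
    apply Measure.ext_of_charFun
    ext t
    rw [charFun_apply_real, charFun_apply_real,
      integral_withDensity_eq_integral_toReal_smul₀ hm.ennreal_ofReal
        (.of_forall fun _ => ENNReal.ofReal_lt_top),
      integral_withDensity_eq_integral_toReal_smul₀ hm.neg.ennreal_ofReal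
        (.of_forall fun _ => ENNReal.ofReal_lt_top), ← sub_eq_zero]
    simp only [ENNReal.toReal_ofReal']
    rw [← integral_sub (hexp t hi.pos_part) (hexp t hi.neg.pos_part),
      ← integral_cexp_mul_eq_zero hu h t]
    congr 1
    ext x
    rw [← sub_smul, Complex.real_smul, mul_comm, Pi.neg_apply]
    congr 2
    rcases le_total 0 (u x) with hx | hx
    · simp [hx]
    · simp [hx]
  rw [withDensity_eq_iff_of_sigmaFinite hm.ennreal_ofReal hm.neg.ennreal_ofReal] at heq
  filter_upwards [heq] with x hx
  rcases lt_trichotomy (u x) 0 with h0 | h0 | h0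
  · rw [ENNReal.ofReal_of_nonpos h0.le, eq_comm, ENNReal.ofReal_eq_zero, Pi.neg_apply] at hx
    simp only [Pi.zero_apply]
    linarith
  · exact h0
  · rw [ENNReal.ofReal_of_nonpos (p := (-u) x) (by simpa using h0.le),
      ENNReal.ofReal_eq_zero] at hx
    simp only [Pi.zero_apply]
    linarith

/-- The Hermite polynomials normalised in `L²` of the standard Gaussian. -/
noncomputable def hermiteNormalized (n : ℕ) : ℝ[X] :=
  C (√(n.factorial : ℝ))⁻¹ * hermiteReal n

theorem eval_hermiteNormalized (n : ℕ) (x : ℝ) :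
    (hermiteNormalized n).eval x = (√(n.factorial : ℝ))⁻¹ * (hermiteReal n).eval x := by
  simp [hermiteNormalized]

theorem integral_hermiteNormalized_mul (i j : ℕ) :
    ∫ x, (hermiteNormalized i).eval x * (hermiteNormalized j).eval x ∂gaussianReal 0 1
      = if i = j then 1 else 0 := by
  have : ∀ x : ℝ, (hermiteNormalized i).eval x * (hermiteNormalized j).eval x
      = ((√(i.factorial : ℝ))⁻¹ * (√(j.factorial : ℝ))⁻¹) *
        ((hermiteReal i).eval x * (hermiteReal j).eval x) := by
    intro x; rw [eval_hermiteNormalized, eval_hermiteNormalized]; ring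
  simp_rw [this]
  rw [integral_const_mul, integral_eval_hermiteReal_mul]
  split_ifs with h
  · subst h
    rw [← mul_inv, Real.mul_self_sqrt (by positivity), inv_mul_cancel₀ (by positivity)]
  · simp

theorem ae_eq_zero_of_integral_hermiteNormalized_mul_eq_zero {u : ℝ → ℝ}
    (hu : MemLp u 2 (gaussianReal 0 1))
    (h : ∀ n : ℕ, ∫ x, (hermiteNormalized n).eval x * u x ∂gaussianReal 0 1 = 0) :
    u =ᵐ[gaussianReal 0 1] 0 := by
  have hH : ∀ n : ℕ, ∫ x, (hermiteReal n).eval x * u x ∂gaussianReal 0 1 = 0 := by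
    intro n
    have := h n
    simp_rw [eval_hermiteNormalized, mul_assoc] at this
    rw [integral_const_mul] at this
    exact (mul_eq_zero.1 this).resolve_left (by positivity)
  let S : Polynomial.Sequence ℝ :=
    ⟨hermiteReal, fun i => by
      rw [degree_eq_natDegree (monic_hermiteReal i).ne_zero, natDegree_hermiteReal]⟩
  have hspan := S.span fun i => by
    change IsUnit (hermiteReal i).leadingCoeff
    simp [(monic_hermiteReal i).leadingCoeff]
  have hall : ∀ p : ℝ[X], ∫ x, p.eval x * u x ∂gaussianReal 0 1 = 0 := by
    intro p
    have hp : p ∈ Submodule.span ℝ (Set.range S) := by rw [hspan]; trivial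
    induction hp using Submodule.span_induction with
    | mem p hp =>
      obtain ⟨n, rfl⟩ := hp
      exact hH n
    | zero => simp
    | add p q _ _ hp hq =>
      simp only [eval_add, add_mul]
      have h1 : Integrable (fun x => p.eval x * u x) (gaussianReal 0 1) :=
        (memLp_eval_gaussianReal p).integrable_mul hu
      have h2 : Integrable (fun x => q.eval x * u x) (gaussianReal 0 1) :=
        (memLp_eval_gaussianReal q).integrable_mul hu
      rw [integral_add h1 h2, hp, hq, add_zero]
    | smul a p _ hp =>
      simp only [eval_smul, smul_eq_mul, mul_assoc]
      rw [integral_const_mul, hp, mul_zero]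
  exact ae_eq_zero_of_integral_pow_mul_eq_zero hu fun n => by simpa using hall (X ^ n)

theorem inner_toLp_toLp {f g : ℝ → ℝ} (hf : MemLp f 2 (gaussianReal 0 1))
    (hg : MemLp g 2 (gaussianReal 0 1)) :
    inner ℝ (hf.toLp f) (hg.toLp g) = ∫ x, f x * g x ∂gaussianReal 0 1 := by
  rw [L2.inner_def]
  refine integral_congr_ae ?_
  filter_upwards [hf.coeFn_toLp, hg.coeFn_toLp] with x h1 h2
  rw [h1, h2]
  simp [mul_comm]

/-- Parseval's identity for the Hermite expansion. -/
theorem hasSum_integral_hermiteNormalized_mul_sq {u : ℝ → ℝ}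
    (hu : MemLp u 2 (gaussianReal 0 1)) :
    HasSum (fun n => (∫ x, (hermiteNormalized n).eval x * u x ∂gaussianReal 0 1) ^ 2)
      (∫ x, u x ^ 2 ∂gaussianReal 0 1) := by
  let e : ℕ → Lp ℝ 2 (gaussianReal 0 1) := fun n =>
    (memLp_eval_gaussianReal (hermiteNormalized n)).toLp _
  have he : Orthonormal ℝ e := by
    rw [orthonormal_iff_ite]
    intro i j
    rw [inner_toLp_toLp, integral_hermiteNormalized_mul]
  have hsp : (Submodule.span ℝ (Set.range e))ᗮ = ⊥ := by
    rw [eq_bot_iff]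
    intro w hw
    have hw2 : MemLp w 2 (gaussianReal 0 1) := Lp.memLp w
    have := ae_eq_zero_of_integral_hermiteNormalized_mul_eq_zero hw2 fun n => by
      rw [← inner_toLp_toLp (memLp_eval_gaussianReal _) hw2, Lp.toLp_coeFn]
      exact (Submodule.mem_orthogonal _ _).1 hw _ (Submodule.subset_span ⟨n, rfl⟩)
    rw [Submodule.mem_bot]
    exact (Lp.eq_zero_iff_ae_eq_zero).2 this
  have hb := (HilbertBasis.mkOfOrthogonalEqBot he hsp).hasSum_inner_mul_inner
    (hu.toLp u) (hu.toLp u)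
  rw [HilbertBasis.coe_mkOfOrthogonalEqBot, inner_toLp_toLp] at hb
  convert! hb using 1
  · ext n
    rw [inner_toLp_toLp, inner_toLp_toLp, sq]
    simp_rw [mul_comm (u _)]
  · simp_rw [sq]

/-- Hermite coefficients of a function with derivatives of all orders in `L²` of the standard
Gaussian decay faster than any power. -/
theorem exists_forall_integral_hermiteNormalized_mul_sq_le {F : ℕ → ℝ → ℝ}
    (hF : ∀ i x, HasDerivAt (F i) (F (i + 1) x) x)
    (hF2 : ∀ i, MemLp (F i) 2 (gaussianReal 0 1)) (j : ℕ) :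
    ∃ K : ℝ, 0 ≤ K ∧ ∀ i : ℕ, 1 ≤ i →
      (∫ x, (hermiteNormalized i).eval x * F 0 x ∂gaussianReal 0 1) ^ 2 ≤ K / (i : ℝ) ^ j := by
  have hbessel : ∀ l i, (∫ x, (hermiteNormalized i).eval x * F l x ∂gaussianReal 0 1) ^ 2
      ≤ ∫ x, F l x ^ 2 ∂gaussianReal 0 1 := fun l i =>
    le_hasSum (hasSum_integral_hermiteNormalized_mul_sq (hF2 l)) i fun _ _ => sq_nonneg _
  have hA : ∀ l, 0 ≤ ∫ x, F l x ^ 2 ∂gaussianReal 0 1 := fun l =>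
    integral_nonneg fun x => sq_nonneg _
  refine ⟨(∫ x, F j x ^ 2 ∂gaussianReal 0 1) * 2 ^ j
    + (∫ x, F 0 x ^ 2 ∂gaussianReal 0 1) * (2 * j) ^ j, ?_, fun i hi => ?_⟩
  · have := hA j; have := hA 0; positivity
  have hi0 : (0 : ℝ) < i := by exact_mod_cast hi
  rw [le_div_iff₀ (by positivity)]
  rcases lt_or_ge i (2 * j) with hij | hij
  · have h1 : (i : ℝ) ^ j ≤ (2 * j) ^ j := by
      gcongr
      exact_mod_cast hij.le
    have h2 := mul_le_mul (hbessel 0 i) h1 (by positivity) (hA 0)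
    have h3 : 0 ≤ (∫ x, F j x ^ 2 ∂gaussianReal 0 1) * 2 ^ j := by
      have := hA j; positivity
    linarith
  · obtain ⟨m, rfl⟩ : ∃ m, i = m + j := ⟨i - j, by omega⟩
    have hcoef : (∫ x, (hermiteNormalized (m + j)).eval x * F 0 x ∂gaussianReal 0 1) ^ 2
        * (m + j).factorial
        = (∫ x, (hermiteNormalized m).eval x * F j x ∂gaussianReal 0 1) ^ 2 * m.factorial := by
      have h := integral_mul_eval_hermiteReal hF hF2 0 m j
      have hn : ∀ l n : ℕ, (∫ x, (hermiteNormalized n).eval x * F l x ∂gaussianReal 0 1) ^ 2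
          * n.factorial = (∫ x, F l x * (hermiteReal n).eval x ∂gaussianReal 0 1) ^ 2 := by
        intro l n
        simp_rw [eval_hermiteNormalized, mul_assoc]
        rw [integral_const_mul, mul_pow, inv_pow, Real.sq_sqrt (by positivity)]
        simp_rw [mul_comm (F l _)]
        field_simp
      rw [hn, hn, h, zero_add]
    have hfac : ((m + j : ℕ) : ℝ) ^ j * m.factorial ≤ 2 ^ j * (m + j).factorial := by
      have h1 := Nat.factorial_mul_descFactorial (Nat.le_add_left j m)
      have h2 := Nat.pow_sub_le_descFactorial (m + j) j
      rw [Nat.add_sub_cancel] at h1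
      have h3 : (m + j) ^ j ≤ 2 ^ j * (m + j).descFactorial j := by
        refine le_trans ?_ (Nat.mul_le_mul_left _ h2)
        rw [← mul_pow]
        exact Nat.pow_le_pow_left (by omega) _
      have h4 : (m + j) ^ j * m.factorial ≤ 2 ^ j * (m + j).factorial := by
        rw [← h1]
        calc _ ≤ _ := Nat.mul_le_mul_right _ h3
          _ = _ := by ring
      exact_mod_cast h4
    have h3 : 0 ≤ (∫ x, F 0 x ^ 2 ∂gaussianReal 0 1) * (2 * j) ^ j := by
      have := hA 0; positivity
    refine le_trans ?_ (le_add_of_nonneg_right h3)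
    have hp : (0 : ℝ) < (m + j).factorial := by positivity
    refine le_of_mul_le_mul_right ?_ hp
    calc _ = (∫ x, (hermiteNormalized (m + j)).eval x * F 0 x ∂gaussianReal 0 1) ^ 2
            * (m + j).factorial * ((m + j : ℕ) : ℝ) ^ j := by ring
      _ = (∫ x, (hermiteNormalized m).eval x * F j x ∂gaussianReal 0 1) ^ 2
            * (((m + j : ℕ) : ℝ) ^ j * m.factorial) := by rw [hcoef]; ring
      _ ≤ (∫ x, F j x ^ 2 ∂gaussianReal 0 1) * (2 ^ j * (m + j).factorial) :=
          mul_le_mul (hbessel j m) hfac (by positivity) (hA j)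
      _ = _ := by ring

/-- A Bernstein-type approximation theorem in `L²` of the standard Gaussian. -/
theorem exists_polynomial_integral_sub_sq_le {F : ℕ → ℝ → ℝ}
    (hF : ∀ i x, HasDerivAt (F i) (F (i + 1) x) x)
    (hF2 : ∀ i, MemLp (F i) 2 (gaussianReal 0 1)) (k : ℕ) :
    ∃ D : ℝ, 0 ≤ D ∧ ∀ n : ℕ, 1 ≤ n → ∃ q : ℝ[X], q.natDegree ≤ n ∧
      ∫ x, (q.eval x - F 0 x) ^ 2 ∂gaussianReal 0 1 ≤ D / (n : ℝ) ^ k := by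
  obtain ⟨K, hK, hKle⟩ := exists_forall_integral_hermiteNormalized_mul_sq_le hF hF2 (k + 2)
  have hsum : Summable fun i : ℕ => 1 / (i : ℝ) ^ 2 :=
    Real.summable_one_div_nat_pow.2 one_lt_two
  refine ⟨K * ∑' i : ℕ, 1 / (i : ℝ) ^ 2, mul_nonneg hK (tsum_nonneg fun i => by positivity),
    fun n hn => ?_⟩
  let c : ℕ → ℝ := fun i => ∫ x, (hermiteNormalized i).eval x * F 0 x ∂gaussianReal 0 1
  let q : ℝ[X] := ∑ i ∈ Finset.range (n + 1), C (c i) * hermiteNormalized i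
  refine ⟨q, ?_, ?_⟩
  · refine natDegree_sum_le_of_forall_le _ _ fun i hi => ?_
    rw [hermiteNormalized, ← mul_assoc, ← C_mul]
    refine (natDegree_C_mul_le _ _).trans ?_
    rw [natDegree_hermiteReal]
    exact Nat.lt_succ_iff.1 (Finset.mem_range.1 hi)
  have hq2 := memLp_eval_gaussianReal q
  have hP := hasSum_integral_hermiteNormalized_mul_sq (hq2.sub (hF2 0))
  simp only [Pi.sub_apply] at hP
  have hcoef : ∀ i, ∫ x, (hermiteNormalized i).eval x * (q.eval x - F 0 x) ∂gaussianReal 0 1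
      = if i < n + 1 then 0 else - c i := by
    intro i
    have h1 : Integrable (fun x => (hermiteNormalized i).eval x * q.eval x) (gaussianReal 0 1) :=
      (memLp_eval_gaussianReal _).integrable_mul hq2
    have h2 : Integrable (fun x => (hermiteNormalized i).eval x * F 0 x) (gaussianReal 0 1) :=
      (memLp_eval_gaussianReal _).integrable_mul (hF2 0)
    simp_rw [mul_sub]
    rw [integral_sub h1 h2]
    have h3 : ∫ x, (hermiteNormalized i).eval x * q.eval x ∂gaussianReal 0 1
        = if i < n + 1 then c i else 0 := by
      simp only [q, eval_finsetSum, eval_mul, eval_C, Finset.mul_sum]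
      rw [integral_finsetSum]
      · simp_rw [mul_left_comm _ (c _), integral_const_mul, integral_hermiteNormalized_mul]
        simp
      · intro l _
        simp_rw [mul_left_comm _ (c _)]
        have : Integrable (fun x => (hermiteNormalized i).eval x * (hermiteNormalized l).eval x)
            (gaussianReal 0 1) :=
          (memLp_eval_gaussianReal _).integrable_mul (memLp_eval_gaussianReal _)
        exact this.const_mul _
    rw [h3]
    split_ifs <;> simp [c]
  simp_rw [hcoef] at hP
  have hn0 : (0 : ℝ) < n := by exact_mod_cast hn
  have hD : HasSum (fun i : ℕ => K / (n : ℝ) ^ k * (1 / (i : ℝ) ^ 2))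
      (K / (n : ℝ) ^ k * ∑' i : ℕ, 1 / (i : ℝ) ^ 2) := hsum.hasSum.mul_left _
  refine (hasSum_le (fun i => ?_) hP hD).trans_eq (by ring)
  split_ifs with hi
  · rw [zero_pow two_ne_zero]
    positivity
  · have hni : n ≤ i := by omega
    have hi0 : (0 : ℝ) < i := hn0.trans_le (by exact_mod_cast hni)
    calc (-c i) ^ 2 = c i ^ 2 := by ring
      _ ≤ K / (i : ℝ) ^ (k + 2) := hKle i (by omega)
      _ = K / (i : ℝ) ^ k * (1 / (i : ℝ) ^ 2) := by rw [pow_add]; field_simp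
      _ ≤ K / (n : ℝ) ^ k * (1 / (i : ℝ) ^ 2) := by gcongr

end Jackson

section Gaussian

open Polynomial

/-- A Bernstein-type approximation theorem in `L²` of a centred Gaussian. -/
theorem exists_polynomial_integral_sub_sq_gaussianReal_le {F : ℕ → ℝ → ℝ}
    (hF : ∀ i x, HasDerivAt (F i) (F (i + 1) x) x) (hFb : ∀ i, ∃ C, ∀ x, |F i x| ≤ C)
    {v : NNReal} (hv : v ≠ 0) (k : ℕ) :
    ∃ D : ℝ, 0 ≤ D ∧ ∀ n : ℕ, 1 ≤ n → ∃ q : ℝ[X], q.natDegree ≤ n ∧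
      Integrable (fun x => (q.eval x - F 0 x) ^ 2) (gaussianReal 0 v) ∧
      ∫ x, (q.eval x - F 0 x) ^ 2 ∂gaussianReal 0 v ≤ D / (n : ℝ) ^ k := by
  set s : ℝ := √v with hs
  have hs0 : s ≠ 0 := (Real.sqrt_pos.2 (by positivity)).ne'
  have hmap : (gaussianReal 0 1).map (fun x => s * x) = gaussianReal 0 v := by
    rw [gaussianReal_map_const_mul]
    congr 1
    · simp
    · ext
      simp [hs, Real.sq_sqrt]
  let G : ℕ → ℝ → ℝ := fun i x => s ^ i * F i (s * x)
  have hG : ∀ i x, HasDerivAt (G i) (G (i + 1) x) x := by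
    intro i x
    have h1 : HasDerivAt (fun x => s * x) s x := by
      simpa using (hasDerivAt_id x).const_mul s
    refine (((hF i (s * x)).comp x h1).const_mul (s ^ i)).congr_deriv ?_
    simp only [G]
    ring
  have hFc : ∀ i, Continuous (F i) := fun i =>
    continuous_iff_continuousAt.2 fun x => (hF i x).continuousAt
  have hG2 : ∀ i, MemLp (G i) 2 (gaussianReal 0 1) := by
    intro i
    obtain ⟨C, hC⟩ := hFb i
    have := hFc i
    refine MemLp.of_bound (C := |s ^ i| * C)
      (Continuous.aestronglyMeasurable (by fun_prop)) (.of_forall fun x => ?_)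
    simp only [G, Real.norm_eq_abs, abs_mul (s ^ i)]
    gcongr
    exact hC _
  obtain ⟨D, hD, hDq⟩ := exists_polynomial_integral_sub_sq_le hG hG2 k
  refine ⟨D, hD, fun n hn => ?_⟩
  obtain ⟨q, hqn, hq⟩ := hDq n hn
  have heval : ∀ x, (q.comp (C s⁻¹ * X)).eval (s * x) - F 0 (s * x) = q.eval x - G 0 x := by
    intro x
    simp [G, inv_mul_cancel_left₀ hs0]
  have hcont : Continuous fun x => ((q.comp (C s⁻¹ * X)).eval x - F 0 x) ^ 2 :=
    ((Polynomial.continuous _).sub (hFc 0)).pow 2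
  refine ⟨q.comp (C s⁻¹ * X), ?_, ?_, ?_⟩
  · rw [natDegree_comp, natDegree_C_mul_X _ (inv_ne_zero hs0), mul_one]
    exact hqn
  · rw [← hmap, integrable_map_measure hcont.aestronglyMeasurable (by fun_prop)]
    have := ((memLp_eval_gaussianReal q).sub (hG2 0)).integrable_sq
    refine this.congr (.of_forall fun x => ?_)
    simp only [Function.comp_apply, heval, Pi.sub_apply]
  · rw [← hmap, integral_map (by fun_prop) hcont.aestronglyMeasurable]
    simp_rw [heval]
    exact hq

end Gaussian

section ExponentialFamily

variable {ν : Measure ℝ}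

/-- The `n`-th moment of the exponential tilting by `t` of the measure `ν`. -/
noncomputable def tiltedMoment (ν : Measure ℝ) (n : ℕ) (t : ℝ) : ℝ :=
  (∫ x, x ^ n * Real.exp (t * x) ∂ν) / ∫ x, Real.exp (t * x) ∂ν

theorem integrable_exp_mul_of_abs_le_const [IsFiniteMeasure ν] {M : ℝ}
    (hM : ∀ᵐ x ∂ν, |x| ≤ M) (t : ℝ) : Integrable (fun x => Real.exp (t * x)) ν := by
  refine Integrable.of_bound (C := Real.exp (|t| * M))
    (Continuous.aestronglyMeasurable (by fun_prop)) ?_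
  filter_upwards [hM] with x hx
  rw [Real.norm_eq_abs, Real.abs_exp, Real.exp_le_exp]
  refine (le_abs_self _).trans ?_
  rw [abs_mul]
  gcongr

theorem integrableExpSet_eq_univ_of_abs_le_const [IsFiniteMeasure ν] {M : ℝ}
    (hM : ∀ᵐ x ∂ν, |x| ≤ M) : integrableExpSet id ν = Set.univ :=
  Set.eq_univ_of_forall fun t => integrable_exp_mul_of_abs_le_const hM t

theorem abs_tiltedMoment_le [IsProbabilityMeasure ν] {M : ℝ}
    (hM : ∀ᵐ x ∂ν, |x| ≤ M) (n : ℕ) (t : ℝ) : |tiltedMoment ν n t| ≤ M ^ n := by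
  have hB : 0 < ∫ x, Real.exp (t * x) ∂ν :=
    integral_exp_pos (integrable_exp_mul_of_abs_le_const hM t)
  rw [tiltedMoment, abs_div, abs_of_pos hB, div_le_iff₀ hB, ← integral_const_mul,
    ← Real.norm_eq_abs]
  refine norm_integral_le_of_norm_le ((integrable_exp_mul_of_abs_le_const hM t).const_mul _) ?_
  filter_upwards [hM] with x hx
  rw [norm_mul, norm_pow, Real.norm_eq_abs, Real.norm_eq_abs, Real.abs_exp]
  gcongr

theorem hasDerivAt_tiltedMoment [IsProbabilityMeasure ν] {M : ℝ}
    (hM : ∀ᵐ x ∂ν, |x| ≤ M) (n : ℕ) (t : ℝ) :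
    HasDerivAt (tiltedMoment ν n)
      (tiltedMoment ν (n + 1) t - tiltedMoment ν n t * tiltedMoment ν 1 t) t := by
  have hB : 0 < ∫ x, Real.exp (t * x) ∂ν :=
    integral_exp_pos (integrable_exp_mul_of_abs_le_const hM t)
  have ht : t ∈ interior (integrableExpSet id ν) := by
    simp [integrableExpSet_eq_univ_of_abs_le_const hM]
  have h0 := hasDerivAt_integral_pow_mul_exp_real ht 0
  have hn := hasDerivAt_integral_pow_mul_exp_real ht n
  simp only [id_eq, pow_zero, one_mul, zero_add] at h0 hn
  refine (hn.div h0 hB.ne').congr_deriv ?_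
  simp only [tiltedMoment]
  field_simp

/-- The mean of the exponential tilting by `t` is a smooth function of `t`, all of whose
derivatives are bounded. -/
theorem exists_bounded_derivatives_tiltedMoment_one [IsProbabilityMeasure ν] {M : ℝ}
    (hM : ∀ᵐ x ∂ν, |x| ≤ M) :
    ∃ F : ℕ → ℝ → ℝ, F 0 = tiltedMoment ν 1 ∧ (∀ i x, HasDerivAt (F i) (F (i + 1) x) x) ∧
      ∀ i, ∃ C, ∀ x, |F i x| ≤ C := by
  let A : Subalgebra ℝ (ℝ → ℝ) := Algebra.adjoin ℝ (Set.range (tiltedMoment ν))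
  have hmem : ∀ n, tiltedMoment ν n ∈ A := fun n => Algebra.subset_adjoin ⟨n, rfl⟩
  have hA : ∀ g ∈ A, (∃ C, ∀ x, |g x| ≤ C) ∧ ∃ g' ∈ A, ∀ x, HasDerivAt g (g' x) x := by
    intro g hg
    induction hg using Algebra.adjoin_induction with
    | mem g hg =>
      obtain ⟨n, rfl⟩ := hg
      exact ⟨⟨M ^ n, abs_tiltedMoment_le hM n⟩,
        tiltedMoment ν (n + 1) - tiltedMoment ν n * tiltedMoment ν 1,
        sub_mem (hmem _) (mul_mem (hmem _) (hmem _)), hasDerivAt_tiltedMoment hM n⟩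
    | algebraMap r =>
      exact ⟨⟨|r|, fun x => le_rfl⟩, 0, zero_mem _, fun x => hasDerivAt_const x r⟩
    | add g h _ _ hg hh =>
      obtain ⟨⟨C, hC⟩, g', hg', hgd⟩ := hg
      obtain ⟨⟨C', hC'⟩, h', hh', hhd⟩ := hh
      exact ⟨⟨C + C', fun x => (abs_add_le _ _).trans (add_le_add (hC x) (hC' x))⟩,
        g' + h', add_mem hg' hh', fun x => (hgd x).add (hhd x)⟩
    | mul g h hgA hhA hg hh =>
      obtain ⟨⟨C, hC⟩, g', hg', hgd⟩ := hg
      obtain ⟨⟨C', hC'⟩, h', hh', hhd⟩ := hh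
      refine ⟨⟨C * C', fun x => ?_⟩,
        g' * h + g * h', add_mem (mul_mem hg' hhA) (mul_mem hgA hh'), fun x => (hgd x).mul (hhd x)⟩
      rw [Pi.mul_apply, abs_mul]
      exact mul_le_mul (hC x) (hC' x) (abs_nonneg _) ((abs_nonneg _).trans (hC x))
  choose d hdA hd using fun g : A => (hA g g.2).2
  let d' : A → A := fun g => ⟨d g, hdA g⟩
  refine ⟨fun i => (d'^[i] ⟨tiltedMoment ν 1, hmem 1⟩ : A), rfl, fun i x => ?_,
    fun i => (hA _ (d'^[i] ⟨tiltedMoment ν 1, hmem 1⟩).2).1⟩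
  simp only [Function.iterate_succ_apply']
  exact hd _ x

end ExponentialFamily

section GaussianChannel

theorem integrable_exp_neg_sq_div_two (ρ : Measure ℝ) [IsFiniteMeasure ρ] :
    Integrable (fun x : ℝ => Real.exp (-x ^ 2 / 2)) ρ := by
  refine Integrable.of_bound (C := 1) (Continuous.aestronglyMeasurable (by fun_prop))
    (.of_forall fun x => ?_)
  rw [Real.norm_eq_abs, Real.abs_exp, Real.exp_le_one_iff]
  nlinarith [sq_nonneg x]

theorem integral_const_add_gaussianReal (x : ℝ) (g : ℝ → ℝ) :
    ∫ z, g (x + z) ∂gaussianReal 0 1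
      = ∫ y, Real.exp (x * y - x ^ 2 / 2) * g y ∂gaussianReal 0 1 := by
  rw [integral_mul_gaussianPDFReal, integral_mul_gaussianPDFReal,
    ← integral_add_left_eq_self
      (fun y => Real.exp (x * y - x ^ 2 / 2) * g y * gaussianPDFReal 0 1 y) x]
  congr 1
  ext z
  have : gaussianPDFReal 0 1 z
      = Real.exp (x * (x + z) - x ^ 2 / 2) * gaussianPDFReal 0 1 (x + z) := by
    simp only [gaussianPDFReal]
    rw [mul_left_comm, ← Real.exp_add]
    congr 2
    simp
    ring
  rw [this]
  ring

theorem gaussianReal_le_smul_gaussianReal {x M : ℝ} (hx : |x| ≤ M) :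
    gaussianReal x 1 ≤ ENNReal.ofReal (√2 * Real.exp (M ^ 2 / 2)) • gaussianReal 0 2 := by
  rw [gaussianReal_of_var_ne_zero _ one_ne_zero, gaussianReal_of_var_ne_zero _ two_ne_zero,
    ← withDensity_smul _ (measurable_gaussianPDF _ _)]
  refine withDensity_mono (.of_forall fun y => ?_)
  rw [Pi.smul_apply, gaussianPDF, gaussianPDF, smul_eq_mul,
    ← ENNReal.ofReal_mul (by positivity)]
  refine ENNReal.ofReal_le_ofReal ?_
  simp only [gaussianPDFReal]
  have h2 : √(2 * Real.pi * ((2 : NNReal) : ℝ)) = √2 * √(2 * Real.pi) := by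
    rw [← Real.sqrt_mul (by norm_num)]
    congr 1
    push_cast
    ring
  have hxM : x ^ 2 ≤ M ^ 2 := sq_le_sq' (abs_le.1 hx).1 (abs_le.1 hx).2
  have hexp : Real.exp (-(y - x) ^ 2 / (2 * ((1 : NNReal) : ℝ)))
      ≤ Real.exp (M ^ 2 / 2) * Real.exp (-(y - 0) ^ 2 / (2 * ((2 : NNReal) : ℝ))) := by
    rw [← Real.exp_add, Real.exp_le_exp]
    push_cast
    nlinarith [sq_nonneg (y - 2 * x)]
  rw [h2]
  calc _ ≤ (√(2 * Real.pi * ((1 : NNReal) : ℝ)))⁻¹ * (Real.exp (M ^ 2 / 2)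
        * Real.exp (-(y - 0) ^ 2 / (2 * ((2 : NNReal) : ℝ)))) := by gcongr
    _ = _ := by
      have h3 : √2 ≠ 0 := by positivity
      have h4 : √(2 * Real.pi) ≠ 0 := by positivity
      simp only [NNReal.coe_one, mul_one]
      field_simp

variable {Ω : Type*} [MeasurableSpace Ω] {P : Measure Ω} [IsProbabilityMeasure P] {X N : Ω → ℝ}

theorem map_add_gaussianReal_le (hXm : Measurable X) (hNm : Measurable N)
    (hN : P.map N = gaussianReal 0 1) (hindep : IndepFun X N P) {M : ℝ}
    (hM : ∀ᵐ x ∂P.map X, |x| ≤ M) :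
    P.map (fun ω => X ω + N ω)
      ≤ ENNReal.ofReal (√2 * Real.exp (M ^ 2 / 2)) • gaussianReal 0 2 := by
  have := Measure.isProbabilityMeasure_map (μ := P) hXm.aemeasurable
  have hprod := (indepFun_iff_map_prod_eq_prod_map_map hXm.aemeasurable hNm.aemeasurable).1 hindep
  rw [hN] at hprod
  have hmap : P.map (fun ω => X ω + N ω)
      = ((P.map X).prod (gaussianReal 0 1)).map (fun p => p.1 + p.2) := by
    rw [← hprod, Measure.map_map (by fun_prop) (by fun_prop)]
    rfl
  rw [hmap]
  refine Measure.le_iff.2 fun S hS => ?_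
  have hS' : MeasurableSet ((fun p : ℝ × ℝ => p.1 + p.2) ⁻¹' S) :=
    measurableSet_preimage (by fun_prop) hS
  rw [Measure.map_apply (by fun_prop) hS, Measure.prod_apply hS']
  calc _ ≤ ∫⁻ _, (ENNReal.ofReal (√2 * Real.exp (M ^ 2 / 2)) • gaussianReal 0 2) S
        ∂P.map X := by
        refine lintegral_mono_ae ?_
        filter_upwards [hM] with x hx
        have h1 : gaussianReal 0 1 (Prod.mk x ⁻¹' ((fun p : ℝ × ℝ => p.1 + p.2) ⁻¹' S))
            = gaussianReal x 1 S := by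
          have h2 := gaussianReal_map_const_add (μ := 0) (v := 1) x
          rw [zero_add] at h2
          rw [← h2, Measure.map_apply (by fun_prop) hS]
          rfl
        rw [h1]
        exact gaussianReal_le_smul_gaussianReal hx S
    _ = _ := by simp

/-- The conditional mean of the input of a Gaussian channel given its output, in terms of
exponential tiltings of the law of the input. -/
theorem condExp_gaussianChannel_ae_eq (hXm : Measurable X) (hNm : Measurable N)
    (hN : P.map N = gaussianReal 0 1) (hindep : IndepFun X N P) {M : ℝ}
    (hM : ∀ᵐ x ∂P.map X, |x| ≤ M) :
    (fun ω => tiltedMoment ((P.map X).tilted fun x => -x ^ 2 / 2) 1 (X ω + N ω)) =ᵐ[P]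
      P[X | MeasurableSpace.comap (fun ω => X ω + N ω) Real.measurableSpace] := by
  have := Measure.isProbabilityMeasure_map (μ := P) hXm.aemeasurable
  have hexp : Integrable (fun x : ℝ => Real.exp (-x ^ 2 / 2)) (P.map X) :=
    integrable_exp_neg_sq_div_two _
  set ν := (P.map X).tilted fun x => -x ^ 2 / 2 with hν
  have : IsProbabilityMeasure ν := isProbabilityMeasure_tilted hexp
  have hMν : ∀ᵐ x ∂ν, |x| ≤ M := (tilted_absolutelyContinuous _ _).ae_le hM
  set f := tiltedMoment ν 1 with hf
  have hfc : Continuous f :=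
    continuous_iff_continuousAt.2 fun x => (hasDerivAt_tiltedMoment hMν 1 x).continuousAt
  have hfM : ∀ y, |f y| ≤ M := fun y => by simpa using abs_tiltedMoment_le hMν 1 y
  have hXM : ∀ᵐ ω ∂P, |X ω| ≤ M := ae_of_ae_map hXm.aemeasurable hM
  have hXi : Integrable X P := Integrable.of_bound hXm.aestronglyMeasurable M hXM
  have hYm : Measurable fun ω => X ω + N ω := hXm.add hNm
  have hfi : Integrable (fun ω => f (X ω + N ω)) P :=
    Integrable.of_bound (hfc.measurable.comp hYm).aestronglyMeasurable M
      (.of_forall fun ω => hfM _)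
  have hprod := (indepFun_iff_map_prod_eq_prod_map_map hXm.aemeasurable hNm.aemeasurable).1 hindep
  rw [hN] at hprod
  have hM2 : ∀ᵐ p ∂(P.map X).prod (gaussianReal 0 1), |p.1| ≤ M :=
    Measure.quasiMeasurePreserving_fst.ae hM
  have hinner : ∀ y, ∫ x, Real.exp (x * y - x ^ 2 / 2) * (x - f y) ∂P.map X = 0 := by
    intro y
    have h0 : ∫ x, (x - f y) * Real.exp (y * x) ∂ν = 0 := by
      have hi0 := integrable_exp_mul_of_abs_le_const hMν y
      have hi1 : Integrable (fun x => x ^ 1 * Real.exp (y * x)) ν :=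
        integrable_pow_mul_exp_of_mem_interior_integrableExpSet (X := id)
          (by simp [integrableExpSet_eq_univ_of_abs_le_const hMν]) 1
      have hB : 0 < ∫ x, Real.exp (y * x) ∂ν := integral_exp_pos hi0
      simp_rw [sub_mul]
      rw [integral_sub (by simpa using hi1) (hi0.const_mul _), integral_const_mul, hf,
        tiltedMoment, div_mul_cancel₀ _ hB.ne']
      simp
    rw [hν, integral_tilted] at h0
    have hZ : 0 < ∫ x, Real.exp (-x ^ 2 / 2) ∂P.map X := integral_exp_pos hexp
    have h1 : ∀ x, (Real.exp (-x ^ 2 / 2) / ∫ x, Real.exp (-x ^ 2 / 2) ∂P.map X) •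
        ((x - f y) * Real.exp (y * x)) = (∫ x, Real.exp (-x ^ 2 / 2) ∂P.map X)⁻¹ *
          (Real.exp (x * y - x ^ 2 / 2) * (x - f y)) := by
      intro x
      have : Real.exp (x * y - x ^ 2 / 2) = Real.exp (-x ^ 2 / 2) * Real.exp (y * x) := by
        rw [← Real.exp_add]; congr 1; ring
      rw [this, smul_eq_mul]
      ring
    simp_rw [h1] at h0
    rw [integral_const_mul] at h0
    exact (mul_eq_zero.1 h0).resolve_left (inv_pos.2 hZ).ne'
  have hkey : ∀ S : Set ℝ, MeasurableSet S →
      ∫ ω, S.indicator (fun _ => (1 : ℝ)) (X ω + N ω) * (X ω - f (X ω + N ω)) ∂P = 0 := by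
    intro S hS
    let I : ℝ → ℝ := S.indicator fun _ => 1
    have hIm : Measurable I := measurable_const.indicator hS
    have hI : ∀ y, |I y| ≤ 1 := fun y => by
      by_cases hy : y ∈ S <;> simp [I, hy]
    have hfm := hfc.measurable
    have hb : ∀ x y, |x| ≤ M → |I y * (x - f y)| ≤ 2 * M := by
      intro x y hx
      rw [abs_mul]
      calc _ ≤ 1 * (|x| + |f y|) :=
            mul_le_mul (hI y) (abs_sub _ _) (abs_nonneg _) zero_le_one
        _ ≤ 2 * M := by linarith [hfM y]
    have hm1 : Measurable fun p : ℝ × ℝ => I (p.1 + p.2) * (p.1 - f (p.1 + p.2)) := by fun_prop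
    have hi1 : Integrable (fun p : ℝ × ℝ => I (p.1 + p.2) * (p.1 - f (p.1 + p.2)))
        ((P.map X).prod (gaussianReal 0 1)) :=
      Integrable.of_bound hm1.aestronglyMeasurable (2 * M) (hM2.mono fun p hp => hb _ _ hp)
    have hi2 : Integrable (Function.uncurry fun x y =>
        Real.exp (x * y - x ^ 2 / 2) * (I y * (x - f y)))
        ((P.map X).prod (gaussianReal 0 1)) := by
      have he : Integrable (fun y : ℝ => 2 * M * Real.exp (M * |y|)) (gaussianReal 0 1) :=
        (integrable_exp_mul_abs (integrable_exp_mul_gaussianReal M)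
          (integrable_exp_mul_gaussianReal (-M))).const_mul _
      refine (he.comp_snd (P.map X)).mono' (Measurable.aestronglyMeasurable
        (by simp only [Function.uncurry_def]; fun_prop)) ?_
      filter_upwards [hM2] with p hp
      simp only [Function.uncurry_def]
      rw [norm_mul, mul_comm, Real.norm_eq_abs, Real.norm_eq_abs, Real.abs_exp]
      refine mul_le_mul (hb _ _ hp) ?_ (Real.exp_nonneg _) ((abs_nonneg _).trans (hb _ 0 hp))
      rw [Real.exp_le_exp]
      have h1 : p.1 * p.2 ≤ M * |p.2| := by
        refine (le_abs_self _).trans ?_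
        rw [abs_mul]
        gcongr
      linarith [sq_nonneg p.1]
    calc _ = ∫ p, I (p.1 + p.2) * (p.1 - f (p.1 + p.2)) ∂(P.map X).prod (gaussianReal 0 1) := by
          rw [← hprod, integral_map (by fun_prop) hm1.aestronglyMeasurable]
      _ = ∫ x, ∫ z, I (x + z) * (x - f (x + z)) ∂gaussianReal 0 1 ∂P.map X :=
          integral_prod _ hi1
      _ = ∫ x, ∫ y, Real.exp (x * y - x ^ 2 / 2) * (I y * (x - f y)) ∂gaussianReal 0 1
            ∂P.map X := by
          congr 1
          ext x
          exact integral_const_add_gaussianReal x fun y => I y * (x - f y)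
      _ = ∫ y, ∫ x, Real.exp (x * y - x ^ 2 / 2) * (I y * (x - f y)) ∂P.map X
            ∂gaussianReal 0 1 := integral_integral_swap hi2
      _ = 0 := by
          simp_rw [mul_left_comm _ (I _), integral_const_mul, hinner]
          simp
  refine ae_eq_condExp_of_forall_setIntegral_eq hYm.comap_le hXi
    (fun s _ _ => hfi.integrableOn) ?_ ?_
  · rintro _ ⟨S, hS, rfl⟩ -
    have hk := hkey S hS
    have hs : MeasurableSet ((fun ω => X ω + N ω) ⁻¹' S) := hYm hS
    have h1 : ∀ ω, S.indicator (fun _ => (1 : ℝ)) (X ω + N ω) * (X ω - f (X ω + N ω))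
        = ((fun ω => X ω + N ω) ⁻¹' S).indicator (fun ω => X ω - f (X ω + N ω)) ω := by
      intro ω
      by_cases hω : X ω + N ω ∈ S <;> simp [hω]
    simp_rw [h1] at hk
    rw [integral_indicator hs, integral_sub hXi.integrableOn hfi.integrableOn,
      sub_eq_zero] at hk
    exact hk.symm
  · exact (hfc.measurable.comp (comap_measurable _)).aestronglyMeasurable

end GaussianChannel

/-- (A Bernstein approximation theorem for conditional expectation.)
Let `X` have a compactly supported, even density `p` that is non-increasing on
`[0,∞) ∩ supp p`, and let `Y = X + N` with `N` a standard Gaussian independent of `X`.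
Then for every `k ≥ 1` there is a constant `D` such that for all `n ≥ max (k-1) 1`, the
`L²`-distance from `E[X|Y]` to polynomials in `Y` of degree at most `n` is at most
`D / n^{k/2}`. -/
theorem bernstein_approx_condexp
    {Ω : Type*} [MeasurableSpace Ω] (P : Measure Ω) [IsProbabilityMeasure P]
    (X N : Ω → ℝ) (hXm : Measurable X) (hNm : Measurable N)
    (p : ℝ → ℝ) (hp0 : ∀ x, 0 ≤ p x)
    (hpd : Measure.map X P = MeasureTheory.volume.withDensity fun x => ENNReal.ofReal (p x))
    (hpc : HasCompactSupport p)
    (hpe : ∀ x, p (-x) = p x)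
    (hpm : AntitoneOn p (Set.Ici 0 ∩ tsupport p))
    (hN : Measure.map N P = gaussianReal 0 1)
    (hindep : IndepFun X N P) :
    ∀ k : ℕ, 1 ≤ k → ∃ D : ℝ, ∀ n : ℕ, max (k - 1) 1 ≤ n →
      Real.sqrt (⨅ c : Fin (n + 1) → ℝ,
          ∫ ω, ((∑ j : Fin (n + 1), c j * (X ω + N ω) ^ (j : ℕ)) -
            (P[X | MeasurableSpace.comap (fun ω => X ω + N ω)
              Real.measurableSpace]) ω) ^ 2 ∂P) ≤
        D / (n : ℝ) ^ ((k : ℝ) / 2) := by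
  obtain ⟨M, hMp⟩ : ∃ M : ℝ, ∀ x, M < |x| → p x = 0 := by
    obtain ⟨M, hM⟩ := hpc.isCompact.isBounded.exists_norm_le
    refine ⟨M, fun x hx => image_eq_zero_of_notMem_tsupport fun hmem => ?_⟩
    exact absurd (hM x hmem) (not_le.2 hx)
  have hM : ∀ᵐ x ∂P.map X, |x| ≤ M := by
    have hs : MeasurableSet {x : ℝ | M < |x|} := measurableSet_lt measurable_const (by fun_prop)
    have h0 : P.map X {x : ℝ | M < |x|} = 0 := by
      rw [hpd, withDensity_apply _ hs, setLIntegral_congr_fun (g := fun _ => 0) hs fun x hx => by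
        simp [hMp x hx]]
      simp
    simpa [ae_iff] using h0
  have := Measure.isProbabilityMeasure_map (μ := P) hXm.aemeasurable
  have hexp : Integrable (fun x : ℝ => Real.exp (-x ^ 2 / 2)) (P.map X) :=
    integrable_exp_neg_sq_div_two _
  have : IsProbabilityMeasure ((P.map X).tilted fun x => -x ^ 2 / 2) :=
    isProbabilityMeasure_tilted hexp
  have hcond := condExp_gaussianChannel_ae_eq hXm hNm hN hindep hM
  obtain ⟨F, hF0, hF, hFb⟩ := exists_bounded_derivatives_tiltedMoment_one
    ((tilted_absolutelyContinuous (P.map X) fun x => -x ^ 2 / 2).ae_le hM)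
  rw [← hF0] at hcond
  intro k _
  obtain ⟨D, hD, hDq⟩ := exists_polynomial_integral_sub_sq_gaussianReal_le hF hFb
    (two_ne_zero (α := NNReal)) k
  set C := √2 * Real.exp (M ^ 2 / 2) with hC
  have hC0 : 0 ≤ C := by positivity
  refine ⟨√(C * D), fun n hn => ?_⟩
  have hn1 : 1 ≤ n := (le_max_right _ _).trans hn
  obtain ⟨q, hqn, hqi, hq⟩ := hDq n hn1
  have hYm : Measurable fun ω => X ω + N ω := hXm.add hNm
  have hcont : Continuous fun y => (q.eval y - F 0 y) ^ 2 :=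
    (q.continuous.sub (continuous_iff_continuousAt.2 fun x => (hF 0 x).continuousAt)).pow 2
  have hbound : ∫ ω, ((∑ j : Fin (n + 1), q.coeff j * (X ω + N ω) ^ (j : ℕ)) -
      (P[X | MeasurableSpace.comap (fun ω => X ω + N ω) Real.measurableSpace]) ω) ^ 2 ∂P
      ≤ C * D / (n : ℝ) ^ k := by
    calc _ = ∫ ω, (q.eval (X ω + N ω) - F 0 (X ω + N ω)) ^ 2 ∂P := by
          refine integral_congr_ae ?_
          filter_upwards [hcond] with ω hω
          rw [← hω, Polynomial.eval_eq_sum_range' (Nat.lt_succ_of_le hqn),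
            Fin.sum_univ_eq_sum_range fun j => q.coeff j * (X ω + N ω) ^ j]
      _ = ∫ y, (q.eval y - F 0 y) ^ 2 ∂P.map (fun ω => X ω + N ω) :=
          (integral_map hYm.aemeasurable hcont.aestronglyMeasurable).symm
      _ ≤ ∫ y, (q.eval y - F 0 y) ^ 2 ∂(ENNReal.ofReal C • gaussianReal 0 2) :=
          integral_mono_measure (map_add_gaussianReal_le hXm hNm hN hindep hM)
            (.of_forall fun y => sq_nonneg _) (hqi.smul_measure ENNReal.ofReal_ne_top)
      _ = C * ∫ y, (q.eval y - F 0 y) ^ 2 ∂gaussianReal 0 2 := by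
          rw [integral_smul_measure, ENNReal.toReal_ofReal hC0, smul_eq_mul]
      _ ≤ C * (D / (n : ℝ) ^ k) := by gcongr
      _ = _ := by ring
  have hpow : (n : ℝ) ^ ((k : ℝ) / 2) = √((n : ℝ) ^ k) := by
    rw [Real.sqrt_eq_rpow, ← Real.rpow_natCast, ← Real.rpow_mul (by positivity)]
    congr 1
    ring
  rw [hpow, ← Real.sqrt_div (by positivity)]
  refine Real.sqrt_le_sqrt ((ciInf_le ⟨0, ?_⟩ fun j : Fin (n + 1) => q.coeff j).trans hbound)
  rintro _ ⟨c, rfl⟩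
  exact integral_nonneg fun ω => sq_nonneg _
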